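/- For every n ≥ 3, there exists a 3 × n Heffter array H(3,n): a 3 × n matrix with entries that are integers in [-3n, 3n] \ {0}, such that every row and column sums to 0 modulo 6n+1, and the absolute values of the entries are exactly {1, ..., 3n}. -/

import Mathlib

/-- From a list of `n` columns with all the needed properties we get the array. -/
theorem heffter_core (n : ℕ) (L : List (ℤ × ℤ × ℤ)) (hlen : L.length = n)
    (h1 : (6 * (n : ℤ) + 1) ∣ (L.map (fun c => c.1)).sum)
    (h2 : (6 * (n : ℤ) + 1) ∣ (L.map (fun c => c.2.1)).sum)
    (h3 : (6 * (n : ℤ) + 1) ∣ (L.map (fun c => c.2.2)).sum)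
    (hc : ∀ c ∈ L, (6 * (n : ℤ) + 1) ∣ c.1 + c.2.1 + c.2.2)
    (hcov : ∀ v : ℤ, 1 ≤ v → v ≤ 3 * n → ∃ c ∈ L, |c.1| = v ∨ |c.2.1| = v ∨ |c.2.2| = v) :
    ∃ A : Fin 3 → Fin n → ℤ,
      (∀ i, (6 * (n : ℤ) + 1) ∣ ∑ j, A i j) ∧
      (∀ j, (6 * (n : ℤ) + 1) ∣ ∑ i, A i j) ∧
      (∀ v ∈ Finset.Icc (1 : ℤ) (3 * n), ∃! p : Fin 3 × Fin n, |A p.1 p.2| = v) := by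
  subst hlen
  let A : Fin 3 → Fin L.length → ℤ := fun i j =>
    ![(L[j]).1, (L[j]).2.1, (L[j]).2.2] i
  have hsum : ∀ f : ℤ × ℤ × ℤ → ℤ, ∑ j : Fin L.length, f L[j] = (L.map f).sum := by
    intro f
    exact Fin.sum_univ_fun_getElem L f
  have hsurj : ∀ v ∈ Finset.Icc (1 : ℤ) (3 * (L.length : ℤ)),
      ∃ p : Fin 3 × Fin L.length, |A p.1 p.2| = v := by
    intro v hv
    rw [Finset.mem_Icc] at hv
    obtain ⟨c, hcL, h⟩ := hcov v hv.1 hv.2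
    obtain ⟨k, hk, rfl⟩ := List.mem_iff_getElem.1 hcL
    rcases h with h | h | h
    · exact ⟨(0, ⟨k, hk⟩), h⟩
    · exact ⟨(1, ⟨k, hk⟩), h⟩
    · exact ⟨(2, ⟨k, hk⟩), h⟩
  have hsub : Finset.Icc (1 : ℤ) (3 * (L.length : ℤ)) ⊆
      Finset.univ.image (fun p : Fin 3 × Fin L.length => |A p.1 p.2|) := by
    intro v hv
    obtain ⟨p, hp⟩ := hsurj v hv
    exact Finset.mem_image.2 ⟨p, Finset.mem_univ _, hp⟩
  have hinj : Function.Injective (fun p : Fin 3 × Fin L.length => |A p.1 p.2|) := by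
    have hcard := Finset.card_le_card hsub
    have hle : (Finset.univ.image (fun p : Fin 3 × Fin L.length => |A p.1 p.2|)).card ≤
      (Finset.univ : Finset (Fin 3 × Fin L.length)).card := Finset.card_image_le
    have heq : (Finset.univ.image (fun p : Fin 3 × Fin L.length => |A p.1 p.2|)).card =
      (Finset.univ : Finset (Fin 3 × Fin L.length)).card := by
      apply le_antisymm hle
      refine le_trans (le_of_eq ?_) hcard
      simp
      omega
    have := Finset.card_image_iff.1 heq
    intro a b hab
    exact this (by simp) (by simp) hab
  refine ⟨A, ?_, ?_, ?_⟩
  · intro i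
    fin_cases i
    · exact (hsum (fun c => c.1)).symm ▸ h1
    · exact (hsum (fun c => c.2.1)).symm ▸ h2
    · exact (hsum (fun c => c.2.2)).symm ▸ h3
  · intro j
    rw [Fin.sum_univ_three]
    exact hc _ (List.getElem_mem j.2)
  · intro v hv
    obtain ⟨p, hp⟩ := hsurj v hv
    exact ⟨p, hp, fun q hq => hinj (hq.trans hp.symm)⟩

/-- A family of `2 m` columns `± (d + 2 i, x - i, -(x + d + i))` with alternating signs. -/
def fam (d x σ : ℤ) : ℕ → List (ℤ × ℤ × ℤ)
  | 0 => []
  | m + 1 => (σ * (d + 2 * (2 * (m : ℤ))), σ * (x - 2 * (m : ℤ)), σ * (-(x + d + 2 * (m : ℤ)))) ::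
      (-σ * (d + 2 * (2 * (m : ℤ) + 1)), -σ * (x - (2 * (m : ℤ) + 1)),
        -σ * (-(x + d + (2 * (m : ℤ) + 1)))) :: fam d x σ m

theorem fam_length (d x σ : ℤ) (m : ℕ) : (fam d x σ m).length = 2 * m := by
  induction m with
  | zero => rfl
  | succ m ih => simp only [fam, List.length_cons, ih]; omega

theorem fam_sum1 (d x σ : ℤ) (m : ℕ) :
    ((fam d x σ m).map (fun c => c.1)).sum = -2 * σ * m := by
  induction m with
  | zero => simp [fam]
  | succ m ih => simp only [fam, List.map_cons, List.sum_cons, ih]; push_cast; ring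

theorem fam_sum2 (d x σ : ℤ) (m : ℕ) :
    ((fam d x σ m).map (fun c => c.2.1)).sum = σ * m := by
  induction m with
  | zero => simp [fam]
  | succ m ih => simp only [fam, List.map_cons, List.sum_cons, ih]; push_cast; ring

theorem fam_sum3 (d x σ : ℤ) (m : ℕ) :
    ((fam d x σ m).map (fun c => c.2.2)).sum = σ * m := by
  induction m with
  | zero => simp [fam]
  | succ m ih => simp only [fam, List.map_cons, List.sum_cons, ih]; push_cast; ring

theorem fam_col (d x σ : ℤ) (m : ℕ) : ∀ c ∈ fam d x σ m, c.1 + c.2.1 + c.2.2 = 0 := by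
  induction m with
  | zero => simp [fam]
  | succ m ih =>
    intro c hc
    simp only [fam, List.mem_cons] at hc
    rcases hc with rfl | rfl | hc
    · ring
    · ring
    · exact ih c hc

theorem fam_mem (d x σ : ℤ) (hσ : σ = 1 ∨ σ = -1) (m : ℕ) (i : ℕ) (hi : i < 2 * m) :
    ∃ c ∈ fam d x σ m, |c.1| = |d + 2 * i| ∧ |c.2.1| = |x - i| ∧ |c.2.2| = |x + d + i| := by
  have hs : |σ| = 1 := by rcases hσ with rfl | rfl <;> simp
  induction m with
  | zero => omega
  | succ m ih =>
    by_cases h : i < 2 * m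
    · obtain ⟨c, hc, h⟩ := ih h
      exact ⟨c, by simp only [fam, List.mem_cons]; tauto, h⟩
    · obtain h | h : i = 2 * m ∨ i = 2 * m + 1 := by omega
      · subst h
        refine ⟨_, List.mem_cons_self, ?_⟩
        simp only [abs_mul, abs_neg, hs, one_mul]
        push_cast
        exact ⟨rfl, rfl, rfl⟩
      · subst h
        refine ⟨_, List.mem_cons_of_mem _ List.mem_cons_self, ?_⟩
        simp only [abs_mul, abs_neg, hs, one_mul]
        push_cast
        exact ⟨rfl, rfl, rfl⟩

/-- A special column: three entries `e * l + c`, each stored as `(e, c)`. -/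
abbrev SCol := (ℤ × ℤ) × (ℤ × ℤ) × (ℤ × ℤ)

/-- Value of a special column. -/
def SCol.ev (l : ℤ) (q : SCol) : ℤ × ℤ × ℤ :=
  (q.1.1 * l + q.1.2, q.2.1.1 * l + q.2.1.2, q.2.2.1 * l + q.2.2.2)

/-- The entry `u * l + w` occurs in the special columns up to sign. -/
def Hit (S : List SCol) (u w : ℤ) : Prop :=
  ∃ q ∈ S, (q.1 = (u, w) ∨ q.1 = (-u, -w)) ∨ (q.2.1 = (u, w) ∨ q.2.1 = (-u, -w)) ∨
    (q.2.2 = (u, w) ∨ q.2.2 = (-u, -w))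

instance (S : List SCol) (u w : ℤ) : Decidable (Hit S u w) := by
  unfold Hit; infer_instance

/-- `(e, c)` is a multiple of the modulus `24 l + 6 K + 1`. -/
def Mul0 (K : ℕ) (e c : ℤ) : Prop := 24 * c = e * (6 * K + 1) ∧ 24 ∣ e

instance (K : ℕ) (e c : ℤ) : Decidable (Mul0 K e c) := by
  unfold Mul0; infer_instance

theorem Mul0.dvd {K : ℕ} {e c : ℤ} (h : Mul0 K e c) (m : ℕ) :
    (6 * ((8 * m + K : ℕ) : ℤ) + 1) ∣ e * (2 * m) + c := by
  obtain ⟨h1, t, rfl⟩ := h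
  refine ⟨t, ?_⟩
  push_cast
  linarith

theorem Hit.cov {S : List SCol} {u w : ℤ} (h : Hit S u w) {l v : ℤ} (hv : v = u * l + w)
    (h0 : 0 ≤ v) : ∃ c ∈ S.map (SCol.ev l), |c.1| = v ∨ |c.2.1| = v ∨ |c.2.2| = v := by
  obtain ⟨q, hq, h⟩ := h
  refine ⟨_, List.mem_map_of_mem hq, ?_⟩
  have key : ∀ p : ℤ × ℤ, (p = (u, w) ∨ p = (-u, -w)) → |p.1 * l + p.2| = v := by
    rintro p (rfl | rfl)
    · simp only [← hv, abs_of_nonneg h0]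
    · have : -u * l + -w = -v := by rw [hv]; ring
      simp only [this, abs_neg, abs_of_nonneg h0]
  rcases h with h | h | h
  · exact Or.inl (key _ h)
  · exact Or.inr (Or.inl (key _ h))
  · exact Or.inr (Or.inr (key _ h))

theorem ev_sum1 (S : List SCol) (l : ℤ) : ((S.map (SCol.ev l)).map (fun c => c.1)).sum =
    (S.map (fun q => q.1.1)).sum * l + (S.map (fun q => q.1.2)).sum := by
  induction S with
  | nil => simp
  | cons q S ih => simp only [List.map_cons, List.sum_cons, ih, SCol.ev]; ring

theorem ev_sum2 (S : List SCol) (l : ℤ) : ((S.map (SCol.ev l)).map (fun c => c.2.1)).sum =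
    (S.map (fun q => q.2.1.1)).sum * l + (S.map (fun q => q.2.1.2)).sum := by
  induction S with
  | nil => simp
  | cons q S ih => simp only [List.map_cons, List.sum_cons, ih, SCol.ev]; ring

theorem ev_sum3 (S : List SCol) (l : ℤ) : ((S.map (SCol.ev l)).map (fun c => c.2.2)).sum =
    (S.map (fun q => q.2.2.1)).sum * l + (S.map (fun q => q.2.2.2)).sum := by
  induction S with
  | nil => simp
  | cons q S ih => simp only [List.map_cons, List.sum_cons, ih, SCol.ev]; ring

/-- The special columns cover the gap `lo ≤ w < hi` at level `u`. -/
def Gap (S : List SCol) (u : ℤ) (lo hi : ℕ) : Prop := ∀ w < hi, lo ≤ w → Hit S u (w : ℤ)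

instance (S : List SCol) (u : ℤ) (lo hi : ℕ) : Decidable (Gap S u lo hi) := by
  unfold Gap; infer_instance

theorem Gap.cov {S : List SCol} {u : ℤ} {lo hi : ℕ} (h : Gap S u lo hi) {l v : ℤ} (h0 : 0 ≤ v)
    (h1 : u * l + lo ≤ v) (h2 : v < u * l + hi) :
    ∃ c ∈ S.map (SCol.ev l), |c.1| = v ∨ |c.2.1| = v ∨ |c.2.2| = v := by
  obtain ⟨w, hw⟩ := Int.eq_ofNat_of_zero_le (a := v - u * l) (by omega)
  exact (h w (by omega) (by omega)).cov (by omega) h0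

set_option maxHeartbeats 4000000 in
theorem heffter_family (K s h c4 c5 c6 c7 c8 c9 c10 c11 : ℕ) (S : List SCol)
    (hlen : S.length = K)
    (hr1 : Mul0 K (S.map (fun q => q.1.1)).sum (S.map (fun q => q.1.2)).sum)
    (hr2 : Mul0 K (S.map (fun q => q.2.1.1)).sum (S.map (fun q => q.2.1.2)).sum)
    (hr3 : Mul0 K (S.map (fun q => q.2.2.1)).sum (S.map (fun q => q.2.2.2)).sum)
    (hcol : ∀ q ∈ S, Mul0 K (q.1.1 + q.2.1.1 + q.2.2.1) (q.1.2 + q.2.1.2 + q.2.2.2))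
    (hs : 1 ≤ s)
    (hd0 : (c6 + 1 = c5 + s ∧ c10 = c9 + s) ∨ (c6 = c5 + s ∧ c10 + 1 = c9 + s))
    (hd2 : (c7 + 1 = c4 + (s + h) ∧ c11 = c8 + (s + h)) ∨
      (c7 = c4 + (s + h) ∧ c11 + 1 = c8 + (s + h)))
    (g0 : Gap S 0 1 s) (g2 : Gap S 2 s (s + h)) (g4 : Gap S 4 (s + h) c4) (g5 : Gap S 5 c4 c5)
    (g6 : Gap S 6 c5 c6) (g7 : Gap S 7 c6 c7) (g8 : Gap S 8 c7 c8) (g9 : Gap S 9 c8 c9)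
    (g10 : Gap S 10 c9 c10) (g11 : Gap S 11 c10 c11) (g12 : Gap S 12 c11 (3 * K + 1))
    (hc4 : 1 ≤ c4) (hc5 : 1 ≤ c5) (hc8 : 1 ≤ c8) (hc9 : 1 ≤ c9)
    (m n : ℕ) (hn : n = 8 * m + K) :
    ∃ A : Fin 3 → Fin n → ℤ,
      (∀ i, (6 * (n : ℤ) + 1) ∣ ∑ j, A i j) ∧
      (∀ j, (6 * (n : ℤ) + 1) ∣ ∑ i, A i j) ∧
      (∀ v ∈ Finset.Icc (1 : ℤ) (3 * n), ∃! p : Fin 3 × Fin n, |A p.1 p.2| = v) := by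
  subst hn
  let F1 := fam (2 * (2 * m) + c7 - c4 + 1) (5 * (2 * m) + c4 - 1) 1 m
  let F2 := fam ((c6 : ℤ) - c5 + 1) (6 * (2 * m) + c5 - 1) (-1) m
  let F3 := fam (2 * (2 * m) + c11 - c8 + 1) (9 * (2 * m) + c8 - 1) 1 m
  let F4 := fam ((c10 : ℤ) - c9 + 1) (10 * (2 * m) + c9 - 1) (-1) m
  refine heffter_core _ (S.map (SCol.ev (2 * m)) ++ (F1 ++ (F2 ++ (F3 ++ F4)))) ?_ ?_ ?_ ?_ ?_ ?_
  · simp only [List.length_append, List.length_map, F1, F2, F3, F4, fam_length, hlen]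
    ring
  · simp only [List.map_append, List.sum_append, F1, F2, F3, F4, fam_sum1, ev_sum1]
    convert hr1.dvd m using 1
    ring
  · simp only [List.map_append, List.sum_append, F1, F2, F3, F4, fam_sum2, ev_sum2]
    convert hr2.dvd m using 1
    ring
  · simp only [List.map_append, List.sum_append, F1, F2, F3, F4, fam_sum3, ev_sum3]
    convert hr3.dvd m using 1
    ring
  · intro c hc
    simp only [List.mem_append] at hc
    rcases hc with hc | hc | hc | hc | hc
    · obtain ⟨q, hq, rfl⟩ := List.mem_map.1 hc
      convert (hcol q hq).dvd m using 1
      simp only [SCol.ev]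
      ring
    all_goals
      rw [fam_col _ _ _ _ c hc]
      exact dvd_zero _
  · intro v hv1 hv2
    push_cast at hv2
    have hS : (∃ c ∈ S.map (SCol.ev (2 * m)), |c.1| = v ∨ |c.2.1| = v ∨ |c.2.2| = v) →
        ∃ c ∈ S.map (SCol.ev (2 * m)) ++ (F1 ++ (F2 ++ (F3 ++ F4))),
          |c.1| = v ∨ |c.2.1| = v ∨ |c.2.2| = v := by
      rintro ⟨c, hc, h⟩
      exact ⟨c, List.mem_append_left _ hc, h⟩
    have hF1 : ∀ i : ℤ, 0 ≤ i → i < 2 * m → (v = 2 * (2 * m) + c7 - c4 + 1 + 2 * i ∨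
        v = 5 * (2 * m) + c4 - 1 - i ∨ v = 7 * (2 * m) + c7 + i) →
        ∃ c ∈ S.map (SCol.ev (2 * m)) ++ (F1 ++ (F2 ++ (F3 ++ F4))),
          |c.1| = v ∨ |c.2.1| = v ∨ |c.2.2| = v := by
      intro i hi0 hi h
      lift i to ℕ using hi0
      obtain ⟨c, hc, e1, e2, e3⟩ := fam_mem (2 * (2 * m) + c7 - c4 + 1) (5 * (2 * m) + c4 - 1) 1
        (by simp) m i (by omega)
      refine ⟨c, by simp only [List.mem_append]; tauto, ?_⟩
      rw [e1, e2, e3]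
      rcases h with h | h | h
      · left; rw [abs_of_nonneg] <;> omega
      · right; left; rw [abs_of_nonneg] <;> omega
      · right; right; rw [abs_of_nonneg] <;> omega
    have hF2 : ∀ i : ℤ, 0 ≤ i → i < 2 * m → (v = c6 - c5 + 1 + 2 * i ∨
        v = 6 * (2 * m) + c5 - 1 - i ∨ v = 6 * (2 * m) + c6 + i) →
        ∃ c ∈ S.map (SCol.ev (2 * m)) ++ (F1 ++ (F2 ++ (F3 ++ F4))),
          |c.1| = v ∨ |c.2.1| = v ∨ |c.2.2| = v := by
      intro i hi0 hi h
      lift i to ℕ using hi0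
      obtain ⟨c, hc, e1, e2, e3⟩ := fam_mem ((c6 : ℤ) - c5 + 1) (6 * (2 * m) + c5 - 1) (-1)
        (by simp) m i (by omega)
      refine ⟨c, by simp only [List.mem_append]; tauto, ?_⟩
      rw [e1, e2, e3]
      rcases h with h | h | h
      · left; rw [abs_of_nonneg] <;> omega
      · right; left; rw [abs_of_nonneg] <;> omega
      · right; right; rw [abs_of_nonneg] <;> omega
    have hF3 : ∀ i : ℤ, 0 ≤ i → i < 2 * m → (v = 2 * (2 * m) + c11 - c8 + 1 + 2 * i ∨
        v = 9 * (2 * m) + c8 - 1 - i ∨ v = 11 * (2 * m) + c11 + i) →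
        ∃ c ∈ S.map (SCol.ev (2 * m)) ++ (F1 ++ (F2 ++ (F3 ++ F4))),
          |c.1| = v ∨ |c.2.1| = v ∨ |c.2.2| = v := by
      intro i hi0 hi h
      lift i to ℕ using hi0
      obtain ⟨c, hc, e1, e2, e3⟩ := fam_mem (2 * (2 * m) + c11 - c8 + 1) (9 * (2 * m) + c8 - 1) 1
        (by simp) m i (by omega)
      refine ⟨c, by simp only [List.mem_append]; tauto, ?_⟩
      rw [e1, e2, e3]
      rcases h with h | h | h
      · left; rw [abs_of_nonneg] <;> omega
      · right; left; rw [abs_of_nonneg] <;> omega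
      · right; right; rw [abs_of_nonneg] <;> omega
    have hF4 : ∀ i : ℤ, 0 ≤ i → i < 2 * m → (v = c10 - c9 + 1 + 2 * i ∨
        v = 10 * (2 * m) + c9 - 1 - i ∨ v = 10 * (2 * m) + c10 + i) →
        ∃ c ∈ S.map (SCol.ev (2 * m)) ++ (F1 ++ (F2 ++ (F3 ++ F4))),
          |c.1| = v ∨ |c.2.1| = v ∨ |c.2.2| = v := by
      intro i hi0 hi h
      lift i to ℕ using hi0
      obtain ⟨c, hc, e1, e2, e3⟩ := fam_mem ((c10 : ℤ) - c9 + 1) (10 * (2 * m) + c9 - 1) (-1)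
        (by simp) m i (by omega)
      refine ⟨c, by simp only [List.mem_append]; tauto, ?_⟩
      rw [e1, e2, e3]
      rcases h with h | h | h
      · left; rw [abs_of_nonneg] <;> omega
      · right; left; rw [abs_of_nonneg] <;> omega
      · right; right; rw [abs_of_nonneg] <;> omega
    have hv0 : 0 ≤ v := by omega
    by_cases b0 : v < s
    · exact hS (g0.cov hv0 (by omega) (by omega))
    by_cases b1 : v < 2 * (2 * m) + s
    · clear g0 g2 g4 g5 g6 g7 g8 g9 g10 g11 g12 hF1 hF3
      obtain ⟨i, hi⟩ : ∃ i : ℤ, v - s = 2 * i ∨ v - s = 2 * i + 1 :=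
        Int.even_or_odd' (v - s)
      rcases hi with hi | hi
      · rcases hd0 with hd0 | hd0
        · exact hF2 i (by omega) (by omega) (by omega)
        · exact hF4 i (by omega) (by omega) (by omega)
      · rcases hd0 with hd0 | hd0
        · exact hF4 i (by omega) (by omega) (by omega)
        · exact hF2 i (by omega) (by omega) (by omega)
    by_cases b2 : v < 2 * (2 * m) + (s + h : ℕ)
    · exact hS (g2.cov hv0 (by omega) (by omega))
    by_cases b3 : v < 4 * (2 * m) + (s + h : ℕ)
    · clear g0 g2 g4 g5 g6 g7 g8 g9 g10 g11 g12 hF2 hF4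
      obtain ⟨i, hi⟩ : ∃ i : ℤ, v - (s + h) = 2 * i ∨ v - (s + h) = 2 * i + 1 :=
        Int.even_or_odd' (v - (s + h))
      rcases hi with hi | hi
      · rcases hd2 with hd2 | hd2
        · exact hF1 (i - 2 * m) (by omega) (by omega) (by omega)
        · exact hF3 (i - 2 * m) (by omega) (by omega) (by omega)
      · rcases hd2 with hd2 | hd2
        · exact hF3 (i - 2 * m) (by omega) (by omega) (by omega)
        · exact hF1 (i - 2 * m) (by omega) (by omega) (by omega)
    by_cases p4 : v < 4 * (2 * m) + c4
    · exact hS (g4.cov hv0 (by omega) (by omega))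
    by_cases q4 : v < 5 * (2 * m) + c4
    · exact hF1 (5 * (2 * m) + c4 - 1 - v) (by omega) (by omega) (by omega)
    by_cases p5 : v < 5 * (2 * m) + c5
    · exact hS (g5.cov hv0 (by omega) (by omega))
    by_cases q5 : v < 6 * (2 * m) + c5
    · exact hF2 (6 * (2 * m) + c5 - 1 - v) (by omega) (by omega) (by omega)
    by_cases p6 : v < 6 * (2 * m) + c6
    · exact hS (g6.cov hv0 (by omega) (by omega))
    by_cases q6 : v < 7 * (2 * m) + c6
    · exact hF2 (v - (6 * (2 * m) + c6)) (by omega) (by omega) (by omega)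
    by_cases p7 : v < 7 * (2 * m) + c7
    · exact hS (g7.cov hv0 (by omega) (by omega))
    by_cases q7 : v < 8 * (2 * m) + c7
    · exact hF1 (v - (7 * (2 * m) + c7)) (by omega) (by omega) (by omega)
    by_cases p8 : v < 8 * (2 * m) + c8
    · exact hS (g8.cov hv0 (by omega) (by omega))
    by_cases q8 : v < 9 * (2 * m) + c8
    · exact hF3 (9 * (2 * m) + c8 - 1 - v) (by omega) (by omega) (by omega)
    by_cases p9 : v < 9 * (2 * m) + c9
    · exact hS (g9.cov hv0 (by omega) (by omega))
    by_cases q9 : v < 10 * (2 * m) + c9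
    · exact hF4 (10 * (2 * m) + c9 - 1 - v) (by omega) (by omega) (by omega)
    by_cases p10 : v < 10 * (2 * m) + c10
    · exact hS (g10.cov hv0 (by omega) (by omega))
    by_cases q10 : v < 11 * (2 * m) + c10
    · exact hF4 (v - (10 * (2 * m) + c10)) (by omega) (by omega) (by omega)
    by_cases p11 : v < 11 * (2 * m) + c11
    · exact hS (g11.cov hv0 (by omega) (by omega))
    by_cases q11 : v < 12 * (2 * m) + c11
    · exact hF3 (v - (11 * (2 * m) + c11)) (by omega) (by omega) (by omega)
    exact hS (g12.cov hv0 (by omega) (by push_cast; omega))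

/-- For every n ≥ 3 there exists a 3 × n Heffter array H(3,n). -/
theorem stmt_17 (n : ℕ) (hn : 3 ≤ n) :
    ∃ A : Fin 3 → Fin n → ℤ,
      (∀ i, (6 * (n : ℤ) + 1) ∣ ∑ j, A i j) ∧
      (∀ j, (6 * (n : ℤ) + 1) ∣ ∑ i, A i j) ∧
      (∀ v ∈ Finset.Icc (1 : ℤ) (3 * n), ∃! p : Fin 3 × Fin n, |A p.1 p.2| = v) := by
  by_cases h3 : n = 3
  · subst h3
    refine heffter_core 3 [(-1, -7, 8), (-5, 3, 2), (6, 4, 9)] rfl (by decide) (by decide) (by decide) (by decide) ?_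
    intro v h1 h2
    norm_num at h2
    interval_cases v <;> decide
  obtain ⟨m, hm⟩ : ∃ m, n = 8 * m + (n - 4) % 8 + 4 := ⟨(n - 4) / 8, by omega⟩
  have hlt : (n - 4) % 8 < 8 := Nat.mod_lt _ (by norm_num)
  generalize (n - 4) % 8 = r at hm hlt
  interval_cases r
  · exact heffter_family 4 1 2 5 7 7 8 10 11 12 12
      [((-9, -10), (-7, -7), (-8, -8)),
        ((-5, -5), (-5, -6), (10, 11)),
        ((-12, -12), (-8, -9), (-4, -4)),
        ((2, 2), (-4, -3), (2, 1))]
      (by decide) (by decide) (by decide) (by decide) (by decide) (by decide) (by decide) (by decide)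
      (by decide) (by decide) (by decide) (by decide) (by decide) (by decide) (by decide) (by decide)
      (by decide) (by decide) (by decide) (by decide) (by decide) (by decide) (by decide) m n hm
  · exact heffter_family 5 2 2 8 9 11 11 12 14 15 16
      [((9, 13), (-4, -5), (-5, -8)),
        ((-9, -12), (-2, -3), (11, 15)),
        ((10, 14), (-6, -10), (-4, -4)),
        ((-4, -6), (4, 7), (0, -1)),
        ((-6, -9), (8, 11), (-2, -2))]
      (by decide) (by decide) (by decide) (by decide) (by decide) (by decide) (by decide) (by decide)
      (by decide) (by decide) (by decide) (by decide) (by decide) (by decide) (by decide) (by decide)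
      (by decide) (by decide) (by decide) (by decide) (by decide) (by decide) (by decide) m n hm
  · exact heffter_family 6 2 2 8 9 10 12 14 15 17 17
      [((7, 10), (-2, -2), (-5, -8)),
        ((0, -1), (-4, -5), (4, 6)),
        ((-4, -4), (12, 17), (-8, -13)),
        ((6, 9), (-10, -16), (4, 7)),
        ((-2, -3), (12, 18), (-10, -15)),
        ((-7, -11), (-8, -12), (-9, -14))]
      (by decide) (by decide) (by decide) (by decide) (by decide) (by decide) (by decide) (by decide)
      (by decide) (by decide) (by decide) (by decide) (by decide) (by decide) (by decide) (by decide)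
      (by decide) (by decide) (by decide) (by decide) (by decide) (by decide) (by decide) m n hm
  · exact heffter_family 7 3 2 9 11 13 13 15 17 20 20
      [((9, 15), (-4, -5), (-5, -10)),
        ((5, 9), (10, 18), (9, 16)),
        ((0, 1), (-2, -4), (2, 3)),
        ((4, 8), (12, 21), (8, 14)),
        ((-10, -19), (10, 17), (0, 2)),
        ((4, 6), (4, 7), (-8, -13)),
        ((-12, -20), (-6, -11), (-6, -12))]
      (by decide) (by decide) (by decide) (by decide) (by decide) (by decide) (by decide) (by decide)
      (by decide) (by decide) (by decide) (by decide) (by decide) (by decide) (by decide) (by decide)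
      (by decide) (by decide) (by decide) (by decide) (by decide) (by decide) (by decide) m n hm
  · exact heffter_family 8 2 3 12 13 15 16 19 20 21 24
      [((-7, -15), (5, 12), (2, 3)),
        ((4, 11), (4, 5), (-8, -16)),
        ((4, 6), (-10, -20), (6, 14)),
        ((-2, -4), (6, 13), (-4, -9)),
        ((-4, -10), (8, 18), (-4, -8)),
        ((0, 1), (-11, -23), (11, 22)),
        ((-11, -21), (2, 2), (9, 19)),
        ((-8, -17), (-4, -7), (12, 24))]
      (by decide) (by decide) (by decide) (by decide) (by decide) (by decide) (by decide) (by decide)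
      (by decide) (by decide) (by decide) (by decide) (by decide) (by decide) (by decide) (by decide)
      (by decide) (by decide) (by decide) (by decide) (by decide) (by decide) (by decide) m n hm
  · exact heffter_family 9 3 2 13 14 17 17 19 22 24 24
      [((9, 21), (-5, -13), (-4, -8)),
        ((12, 27), (4, 10), (8, 18)),
        ((0, 2), (-4, -7), (4, 5)),
        ((2, 4), (-12, -26), (10, 22)),
        ((6, 14), (-10, -23), (4, 9)),
        ((4, 6), (-8, -17), (4, 11)),
        ((-12, -24), (0, -1), (12, 25)),
        ((9, 20), (9, 19), (6, 16)),
        ((-6, -15), (2, 3), (4, 12))]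
      (by decide) (by decide) (by decide) (by decide) (by decide) (by decide) (by decide) (by decide)
      (by decide) (by decide) (by decide) (by decide) (by decide) (by decide) (by decide) (by decide)
      (by decide) (by decide) (by decide) (by decide) (by decide) (by decide) (by decide) m n hm
  · exact heffter_family 10 5 3 12 14 19 19 23 24 28 31
      [((8, 22), (-8, -20), (0, -2)),
        ((6, 18), (4, 8), (-10, -26)),
        ((-11, -28), (9, 23), (2, 5)),
        ((4, 9), (-10, -24), (6, 15)),
        ((4, 10), (-6, -17), (2, 7)),
        ((-4, -11), (10, 25), (-6, -14)),
        ((-10, -27), (2, 6), (8, 21)),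
        ((0, 1), (0, 3), (0, -4)),
        ((8, 19), (5, 12), (11, 30)),
        ((-5, -13), (-6, -16), (11, 29))]
      (by decide) (by decide) (by decide) (by decide) (by decide) (by decide) (by decide) (by decide)
      (by decide) (by decide) (by decide) (by decide) (by decide) (by decide) (by decide) (by decide)
      (by decide) (by decide) (by decide) (by decide) (by decide) (by decide) (by decide) m n hm
  · exact heffter_family 11 3 5 14 16 18 21 22 26 29 30
      [((-8, -21), (12, 31), (-4, -10)),
        ((9, 24), (0, 1), (-9, -25)),
        ((2, 5), (-7, -19), (5, 14)),
        ((-9, -23), (5, 15), (4, 8)),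
        ((-12, -32), (12, 30), (0, 2)),
        ((12, 33), (-2, -7), (-10, -26)),
        ((2, 3), (4, 13), (-6, -16)),
        ((-4, -9), (-7, -20), (11, 29)),
        ((2, 4), (-9, -22), (7, 18)),
        ((-4, -11), (6, 17), (-2, -6)),
        ((10, 27), (10, 28), (4, 12))]
      (by decide) (by decide) (by decide) (by decide) (by decide) (by decide) (by decide) (by decide)
      (by decide) (by decide) (by decide) (by decide) (by decide) (by decide) (by decide) (by decide)
      (by decide) (by decide) (by decide) (by decide) (by decide) (by decide) (by decide) m n hm
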